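/- arXiv:0906.2815 — 10 statements merged into one kernel-verified Lean document; each statement's English description precedes it below -/
import Mathlib

section
/- Let k be a field of characteristic ≠ 2 and let A₀, A₁ be 3×3 matrices over k with A₀ᵀ = A₀ and A₁ᵀ = A₁ (the symmetric QRT case, ε = -1). Let (f₁(y), f₂(y), f₃(y)) = (A₀X(y)) × (A₁X(y)). Then the map φ(x,y) = (y, x̃) with x̃ = (f₁(y) - f₂(y)x)/(f₂(y) - f₃(y)x) preserves I: for all x, y ∈ k such that f₂(y) - f₃(y)x ≠ 0, D(x,y) ≠ 0 and D(y, x̃) ≠ 0, one has I(y, x̃) = I(x,y). -/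
open Matrix

noncomputable section

/-- The vector `X(t) = (t², t, 1)` in `k³`. -/
def Xv {k : Type*} [Field k] (t : k) : Fin 3 → k := ![t ^ 2, t, 1]

/-- The biquadratic form `X(x)ᵀ A X(y)` associated to a 3×3 matrix `A`. -/
def Nf {k : Type*} [Field k] (A : Matrix (Fin 3) (Fin 3) k) (x y : k) : k :=
  Xv x ⬝ᵥ A.mulVec (Xv y)

/-- The rational invariant `I(x,y) = N(x,y)/D(x,y)` where `N` uses `A₀` and `D` uses `A₁`. -/
def Iinv {k : Type*} [Field k] (A₀ A₁ : Matrix (Fin 3) (Fin 3) k) (x y : k) : k :=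
  Nf A₀ x y / Nf A₁ x y

/-- A biquadratic form with symmetric matrix is symmetric in its arguments. -/
lemma Nf_comm_of_transpose_eq {k : Type*} [Field k] {A : Matrix (Fin 3) (Fin 3) k}
    (hA : Aᵀ = A) (x y : k) : Nf A x y = Nf A y x := by
  rw [Nf, Nf, dotProduct_mulVec, ← mulVec_transpose, hA, dotProduct_comm]

/-- The Binet-Cauchy identity for `(u ⨯₃ v) ⬝ᵥ (Xv s ⨯₃ Xv t)`, with the factor `s - t` of
`Xv s ⨯₃ Xv t` pulled out. -/
lemma Xv_dotProduct_mul_sub_mul {k : Type*} [Field k] (u v : Fin 3 → k) (s t : k) :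
    (Xv s ⬝ᵥ u) * (Xv t ⬝ᵥ v) - (Xv t ⬝ᵥ u) * (Xv s ⬝ᵥ v) =
      (s - t) * (crossProduct u v 0 - crossProduct u v 1 * (s + t)
        + crossProduct u v 2 * (s * t)) := by
  simp [Xv, crossProduct, dotProduct, Fin.sum_univ_three]
  ring

theorem stmt1 {k : Type*} [Field k] (hchar : (2 : k) ≠ 0)
    (A₀ A₁ : Matrix (Fin 3) (Fin 3) k)
    (hA₀ : A₀ᵀ = A₀) (hA₁ : A₁ᵀ = A₁)
    (x y : k)
    (f : Fin 3 → k) (hf : f = crossProduct (A₀.mulVec (Xv y)) (A₁.mulVec (Xv y)))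
    (hden : f 1 - f 2 * x ≠ 0)
    (x' : k) (hx' : x' = (f 0 - f 1 * x) / (f 1 - f 2 * x))
    (hD : Nf A₁ x y ≠ 0) (hD' : Nf A₁ y x' ≠ 0) :
    Iinv A₀ A₁ y x' = Iinv A₀ A₁ x y := by
  rw [eq_div_iff hden] at hx'
  rw [Nf_comm_of_transpose_eq hA₁] at hD'
  rw [Iinv, Iinv, Nf_comm_of_transpose_eq hA₀ y, Nf_comm_of_transpose_eq hA₁ y,
    div_eq_div_iff hD' hD]
  have h := Xv_dotProduct_mul_sub_mul (A₀.mulVec (Xv y)) (A₁.mulVec (Xv y)) x' x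
  rw [← hf] at h
  simp only [Nf]
  linear_combination h - (x' - x) * hx'
end
end

section
/- Let k be a field of characteristic ≠ 2 and let A₀, A₁ be 3×3 matrices over k with A₀ᵀ = -A₀ (antisymmetric) and A₁ᵀ = A₁ (symmetric), i.e. the case ε = 1. Let (f₁(y), f₂(y), f₃(y)) = (A₀X(y)) × (A₁X(y)). Then the map φ(x,y) = (y, x̃) with x̃ = (f₁(y) - f₂(y)x)/(f₂(y) - f₃(y)x) anti-preserves I: for all x, y ∈ k such that f₂(y) - f₃(y)x ≠ 0, D(x,y) ≠ 0 and D(y, x̃) ≠ 0, one has I(y, x̃) = -I(x,y); in particular φ preserves the biquartic invariant I², so it is a non-QRT map. -/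
open Matrix

noncomputable section

theorem Nf_transpose {k : Type*} [Field k] (A : Matrix (Fin 3) (Fin 3) k) (x y : k) :
    Nf Aᵀ x y = Nf A y x := by
  rw [Nf, Nf, mulVec_transpose, dotProduct_comm, dotProduct_mulVec]

theorem Nf_neg {k : Type*} [Field k] (A : Matrix (Fin 3) (Fin 3) k) (x y : k) :
    Nf (-A) x y = -Nf A x y := by
  rw [Nf, Nf, neg_mulVec, dotProduct_neg]

/-- The difference of the cross-multiplied values of two forms on the curve `X` factors through
the cross product of their coefficient vectors. -/
theorem Xv_dotProduct_mul_sub {k : Type*} [Field k] (a b : Fin 3 → k) (s t : k) :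
    (Xv s ⬝ᵥ a) * (Xv t ⬝ᵥ b) - (Xv t ⬝ᵥ a) * (Xv s ⬝ᵥ b) =
      (s - t) * (crossProduct a b 0 - crossProduct a b 1 * t -
        s * (crossProduct a b 1 - crossProduct a b 2 * t)) := by
  simp [Xv, cross_apply, dotProduct, Fin.sum_univ_three]
  ring

theorem stmt2 {k : Type*} [Field k] (hchar : (2 : k) ≠ 0)
    (A₀ A₁ : Matrix (Fin 3) (Fin 3) k)
    (hA₀ : A₀ᵀ = -A₀) (hA₁ : A₁ᵀ = A₁)
    (x y : k)
    (f : Fin 3 → k) (hf : f = crossProduct (A₀.mulVec (Xv y)) (A₁.mulVec (Xv y)))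
    (hden : f 1 - f 2 * x ≠ 0)
    (x' : k) (hx' : x' = (f 0 - f 1 * x) / (f 1 - f 2 * x))
    (hD : Nf A₁ x y ≠ 0) (hD' : Nf A₁ y x' ≠ 0) :
    Iinv A₀ A₁ y x' = -Iinv A₀ A₁ x y ∧
    (Iinv A₀ A₁ y x') ^ 2 = (Iinv A₀ A₁ x y) ^ 2 := by
  have hswap : Nf A₀ y x' = -Nf A₀ x' y := by rw [← Nf_transpose, hA₀, Nf_neg]
  have hsymm : Nf A₁ y x' = Nf A₁ x' y := by rw [← Nf_transpose, hA₁]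
  rw [hsymm] at hD'
  have hpreserve : Nf A₀ x' y / Nf A₁ x' y = Nf A₀ x y / Nf A₁ x y := by
    rw [div_eq_div_iff hD' hD, ← sub_eq_zero]
    unfold Nf
    rw [Xv_dotProduct_mul_sub, ← hf, hx', div_mul_cancel₀ _ hden, sub_self, mul_zero]
  have hanti : Iinv A₀ A₁ y x' = -Iinv A₀ A₁ x y := by
    rw [Iinv, Iinv, hswap, hsymm, neg_div, hpreserve]
  exact ⟨hanti, by rw [hanti, neg_sq]⟩
end
end

section
/- Let k be a field of characteristic ≠ 2 and let A₀, A₁ be arbitrary 3×3 matrices over k. Let (f₁(y), f₂(y), f₃(y)) = (A₀X(y)) × (A₁X(y)). Then the QRT involution i₁ : (x,y) ↦ (x̃, y) with x̃ = (f₁(y) - f₂(y)x)/(f₂(y) - f₃(y)x) preserves I: for all x, y ∈ k such that f₂(y) - f₃(y)x ≠ 0, D(x,y) ≠ 0 and D(x̃, y) ≠ 0, one has I(x̃, y) = I(x,y). -/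
open Matrix

noncomputable section

theorem stmt3 {k : Type*} [Field k] (hchar : (2 : k) ≠ 0)
    (A₀ A₁ : Matrix (Fin 3) (Fin 3) k)
    (x y : k)
    (f : Fin 3 → k) (hf : f = crossProduct (A₀.mulVec (Xv y)) (A₁.mulVec (Xv y)))
    (hden : f 1 - f 2 * x ≠ 0)
    (x' : k) (hx' : x' = (f 0 - f 1 * x) / (f 1 - f 2 * x))
    (hD : Nf A₁ x y ≠ 0) (hD' : Nf A₁ x' y ≠ 0) :
    Iinv A₀ A₁ x' y = Iinv A₀ A₁ x y := by
  rw [eq_div_iff hden] at hx'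
  unfold Iinv
  rw [div_eq_div_iff hD' hD]
  unfold Nf
  generalize A₀.mulVec (Xv y) = a at *
  generalize A₁.mulVec (Xv y) = b at *
  subst hf
  simp only [cross_apply, Xv, dotProduct, Fin.sum_univ_three, cons_val_zero, cons_val_one,
    cons_val] at hx' ⊢
  linear_combination (x - x') * hx'
end
end

section
/- Let k be a field of characteristic ≠ 2 and let A₀, A₁ be arbitrary 3×3 matrices over k. Let (g₁(x), g₂(x), g₃(x)) = (A₀ᵀX(x)) × (A₁ᵀX(x)). Then the QRT involution i₂ : (x,y) ↦ (x, ȳ) with ȳ = (g₁(x) - g₂(x)y)/(g₂(x) - g₃(x)y) preserves I: for all x, y ∈ k such that g₂(x) - g₃(x)y ≠ 0, D(x,y) ≠ 0 and D(x, ȳ) ≠ 0, one has I(x, ȳ) = I(x,y). -/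
open Matrix

noncomputable section

/-- The form `X(x)ᵀ A X(y)` is the quadratic polynomial in `y` with coefficient vector `Aᵀ X(x)`. -/
theorem Nf_eq_transpose_mulVec {k : Type*} [Field k] (A : Matrix (Fin 3) (Fin 3) k) (x y : k) :
    Nf A x y = Aᵀ.mulVec (Xv x) ⬝ᵥ Xv y := by
  rw [Nf, dotProduct_mulVec, mulVec_transpose]

/-- The `2 × 2` minor of the values of two quadratics `a`, `b` at `y`, `z`, by the
Cauchy–Binet identity. -/
theorem dotProduct_Xv_mul_sub {k : Type*} [Field k] (a b : Fin 3 → k) (y z : k) :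
    (a ⬝ᵥ Xv z) * (b ⬝ᵥ Xv y) - (a ⬝ᵥ Xv y) * (b ⬝ᵥ Xv z) =
      (z - y) * (crossProduct a b 0 - crossProduct a b 1 * (y + z) +
        crossProduct a b 2 * (y * z)) := by
  simp [Xv, cross_apply, dotProduct, Fin.sum_univ_three]
  ring

theorem stmt5 {k : Type*} [Field k] (hchar : (2 : k) ≠ 0)
    (A₀ A₁ : Matrix (Fin 3) (Fin 3) k)
    (x y : k)
    (g : Fin 3 → k) (hg : g = crossProduct (A₀ᵀ.mulVec (Xv x)) (A₁ᵀ.mulVec (Xv x)))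
    (hden : g 1 - g 2 * y ≠ 0)
    (y' : k) (hy' : y' = (g 0 - g 1 * y) / (g 1 - g 2 * y))
    (hD : Nf A₁ x y ≠ 0) (hD' : Nf A₁ x y' ≠ 0) :
    Iinv A₀ A₁ x y' = Iinv A₀ A₁ x y := by
  have hroot : g 0 - g 1 * (y + y') + g 2 * (y * y') = 0 := by
    rw [eq_div_iff hden] at hy'
    linear_combination -hy'
  rw [Iinv, Iinv, div_eq_div_iff hD' hD, ← sub_eq_zero]
  simp only [Nf_eq_transpose_mulVec]
  rw [dotProduct_Xv_mul_sub, ← hg, hroot, mul_zero]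
end
end

section
/- Let k be a field of characteristic ≠ 2, let α, β, γ, δ, ζ ∈ k, and set A₀ = [[0,0,α],[0,β,0],[-α,0,0]] and A₁ = [[γ,0,δ],[0,0,0],[δ,0,ζ]]. Define the map φ(x,y) = (-y, ȳ) where ȳ = (βy(δy² + ζ) + αx(2δy² + γy⁴ + ζ)) / (βxy(δ + γy²) - α(2δy² + γy⁴ + ζ)). Then for all x, y ∈ k such that the denominator of ȳ is nonzero, D(x,y) ≠ 0 and D(-y, ȳ) ≠ 0, one has I(-y, ȳ) = -I(x,y); in particular φ preserves the biquartic invariant I², so it is a non-QRT map. -/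
open Matrix

noncomputable section

theorem Nf_eq_of_skew {k : Type*} [Field k] (α β x y : k) :
    Nf !![0, 0, α; 0, β, 0; -α, 0, 0] x y = α * x ^ 2 + β * x * y - α * y ^ 2 := by
  simp [Nf, Xv, Matrix.mulVec, dotProduct, Fin.sum_univ_three]
  ring

theorem Nf_eq_of_symm {k : Type*} [Field k] (γ δ ζ x y : k) :
    Nf !![γ, 0, δ; 0, 0, 0; δ, 0, ζ] x y =
      γ * x ^ 2 * y ^ 2 + δ * (x ^ 2 + y ^ 2) + ζ := by
  simp [Nf, Xv, Matrix.mulVec, dotProduct, Fin.sum_univ_three]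
  ring

theorem stmt7 {k : Type*} [Field k] (hchar : (2 : k) ≠ 0) (α β γ δ ζ : k)
    (A₀ A₁ : Matrix (Fin 3) (Fin 3) k)
    (hA₀ : A₀ = !![0, 0, α; 0, β, 0; -α, 0, 0])
    (hA₁ : A₁ = !![γ, 0, δ; 0, 0, 0; δ, 0, ζ]) :
    ∀ x y : k,
      β * x * y * (δ + γ * y ^ 2) - α * (2 * δ * y ^ 2 + γ * y ^ 4 + ζ) ≠ 0 →
      ∀ y' : k,
        y' = (β * y * (δ * y ^ 2 + ζ) + α * x * (2 * δ * y ^ 2 + γ * y ^ 4 + ζ)) /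
          (β * x * y * (δ + γ * y ^ 2) - α * (2 * δ * y ^ 2 + γ * y ^ 4 + ζ)) →
        Nf A₁ x y ≠ 0 → Nf A₁ (-y) y' ≠ 0 →
        Iinv A₀ A₁ (-y) y' = -Iinv A₀ A₁ x y ∧
        (Iinv A₀ A₁ (-y) y') ^ 2 = (Iinv A₀ A₁ x y) ^ 2 := by
  intro x y hQ y' hy' hD hD'
  have hneg : Iinv A₀ A₁ (-y) y' = -Iinv A₀ A₁ x y := by
    subst hA₀ hA₁
    rw [eq_div_iff hQ] at hy'
    rw [Iinv, Iinv, ← neg_div, div_eq_div_iff hD' hD]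
    simp only [Nf_eq_of_skew, Nf_eq_of_symm]
    linear_combination (y' - x) * hy'
  exact ⟨hneg, by rw [hneg, neg_sq]⟩
end
end

section
/- Let k be a field of characteristic ≠ 2, let α, β, γ, δ, ε, ζ, κ, λ, μ, b, c, f, m ∈ k, and set A₀ = [[α,β,γ],[δ,ε,ζ],[κ,λ,μ]] and A₁ = [[α₁,β₁,γ₁],[δ₁,ε₁,ζ₁],[κ₁,λ₁,μ₁]] where α₁ = 2α²f - cαδ + bβδ - bαε, β₁ = 2fαβ + bγδ - cαε - bαζ, γ₁ = 2fαγ - cαζ, δ₁ = 2mα² - 2cακ + 2bβκ - 2bαλ, ε₁ = 2mαβ + 2bγκ - 2cαλ - 2bαμ, ζ₁ = 2mαγ - 2cαμ, κ₁ = mαδ - 2fακ + bεκ - bδλ, λ₁ = mαε + bζκ - 2fαλ - bδμ, μ₁ = mαζ - 2fαμ. Define h₁(x,y) = (x̄, y) with x̄ = -((δy² + εy + ζ)x + 2(κy² + λy + μ)) / (2(αy² + βy + γ)x + δy² + εy + ζ). Then for all x, y ∈ k such that the denominator of x̄ is nonzero, D(x,y) ≠ 0 and D(x̄, y) ≠ 0,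 one has I(x̄, y) = -I(x,y). -/
open Matrix

noncomputable section

theorem Nf_of {k : Type*} [Field k] (a b c d e f g h i x y : k) :
    Nf !![a, b, c; d, e, f; g, h, i] x y =
      (a * y ^ 2 + b * y + c) * x ^ 2 + (d * y ^ 2 + e * y + f) * x
        + (g * y ^ 2 + h * y + i) := by
  simp [Nf, Xv, dotProduct, mulVec, Fin.sum_univ_three]
  ring

/-- If the quadratics `(a, d, e)` and `(a₁, d₁, e₁)` are apolar, the involution fixing the roots
of the first one negates their quotient. -/
theorem div_eq_neg_div_of_apolar {k : Type*} [Field k] {a d e a₁ d₁ e₁ x x' : k}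
    (hpolar : 2 * a * e₁ + 2 * e * a₁ - d * d₁ = 0)
    (hden : 2 * a * x + d ≠ 0) (hx' : x' = -((d * x + 2 * e) / (2 * a * x + d)))
    (hD : a₁ * x ^ 2 + d₁ * x + e₁ ≠ 0) (hD' : a₁ * x' ^ 2 + d₁ * x' + e₁ ≠ 0) :
    (a * x' ^ 2 + d * x' + e) / (a₁ * x' ^ 2 + d₁ * x' + e₁) =
      -((a * x ^ 2 + d * x + e) / (a₁ * x ^ 2 + d₁ * x + e₁)) := by
  have hs : x' * (2 * a * x + d) = -(d * x + 2 * e) := by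
    rw [hx', neg_mul, div_mul_cancel₀ _ hden]
  have hscale (p q r : k) : (p * x' ^ 2 + q * x' + r) * (2 * a * x + d) ^ 2 =
      p * (d * x + 2 * e) ^ 2 - q * (d * x + 2 * e) * (2 * a * x + d)
        + r * (2 * a * x + d) ^ 2 := by
    linear_combination (p * (x' * (2 * a * x + d) - (d * x + 2 * e)) + q * (2 * a * x + d)) * hs
  have hN : (a * x' ^ 2 + d * x' + e) * (2 * a * x + d) ^ 2 =
      (4 * a * e - d ^ 2) * (a * x ^ 2 + d * x + e) := by
    rw [hscale]; ring
  have hQ : (a₁ * x' ^ 2 + d₁ * x' + e₁) * (2 * a * x + d) ^ 2 =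
      -(4 * a * e - d ^ 2) * (a₁ * x ^ 2 + d₁ * x + e₁) := by
    rw [hscale]
    linear_combination (2 * a * x ^ 2 + 2 * d * x + 2 * e) * hpolar
  rw [← neg_div, div_eq_div_iff hD' hD]
  apply mul_right_cancel₀ (pow_ne_zero 2 hden)
  linear_combination (a₁ * x ^ 2 + d₁ * x + e₁) * hN + (a * x ^ 2 + d * x + e) * hQ

theorem stmt9 {k : Type*} [Field k] (hchar : (2 : k) ≠ 0)
    (α β γ δ ε ζ κ lam μ b c f m : k)
(α₁ β₁ γ₁ δ₁ ε₁ ζ₁ κ₁ lam₁ μ₁ : k)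
    (hα₁ : α₁ = 2 * α ^ 2 * f - c * α * δ + b * β * δ - b * α * ε)
    (hβ₁ : β₁ = 2 * f * α * β + b * γ * δ - c * α * ε - b * α * ζ)
    (hγ₁ : γ₁ = 2 * f * α * γ - c * α * ζ)
    (hδ₁ : δ₁ = 2 * m * α ^ 2 - 2 * c * α * κ + 2 * b * β * κ - 2 * b * α * lam)
    (hε₁ : ε₁ = 2 * m * α * β + 2 * b * γ * κ - 2 * c * α * lam - 2 * b * α * μ)
    (hζ₁ : ζ₁ = 2 * m * α * γ - 2 * c * α * μ)
    (hκ₁ : κ₁ = m * α * δ - 2 * f * α * κ + b * ε * κ - b * δ * lam)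
    (hlam₁ : lam₁ = m * α * ε + b * ζ * κ - 2 * f * α * lam - b * δ * μ)
    (hμ₁ : μ₁ = m * α * ζ - 2 * f * α * μ)
    (A₀ A₁ : Matrix (Fin 3) (Fin 3) k)
    (hA₀ : A₀ = !![α, β, γ; δ, ε, ζ; κ, lam, μ])
    (hA₁ : A₁ = !![α₁, β₁, γ₁; δ₁, ε₁, ζ₁; κ₁, lam₁, μ₁])
    (x y x' : k)
    (hden : 2 * (α * y ^ 2 + β * y + γ) * x + (δ * y ^ 2 + ε * y + ζ) ≠ 0)
    (hx' : x' = -(((δ * y ^ 2 + ε * y + ζ) * x + 2 * (κ * y ^ 2 + lam * y + μ)) /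
      (2 * (α * y ^ 2 + β * y + γ) * x + (δ * y ^ 2 + ε * y + ζ))))
    (hD : Nf A₁ x y ≠ 0) (hD' : Nf A₁ x' y ≠ 0) :
    Iinv A₀ A₁ x' y = -Iinv A₀ A₁ x y := by
  subst hA₀ hA₁
  simp only [Iinv, Nf_of] at hD hD' ⊢
  refine div_eq_neg_div_of_apolar ?_ hden hx' hD hD'
  rw [hα₁, hβ₁, hγ₁, hδ₁, hε₁, hζ₁, hκ₁, hlam₁, hμ₁]
  ring
end
end

section
/- Let k be a field of characteristic ≠ 2, let α, β, γ, δ, ε, ζ, κ, λ, μ, b, c, f, m ∈ k, set A₀ = [[α,β,γ],[δ,ε,ζ],[κ,λ,μ]] and let A₁ be the matrix with entries α₁ = 2α²f - cαδ + bβδ - bαε, β₁ = 2fαβ + bγδ - cαε - bαζ, γ₁ = 2fαγ - cαζ, δ₁ = 2mα² - 2cακ + 2bβκ - 2bαλ, ε₁ = 2mαβ + 2bγκ - 2cαλ - 2bαμ, ζ₁ = 2mαγ - 2cαμ, κ₁ = mαδ - 2fακ + bεκ - bδλ, λ₁ = mαε + bζκ - 2fαλ - bδμ, μ₁ = mαζ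 - 2fαμ. Define the asymmetric non-QRT map φ(x,y) = (x̄, ȳ) where x̄ = -((δy² + εy + ζ)x + 2(κy² + λy + μ)) / (2(αy² + βy + γ)x + δy² + εy + ζ) and ȳ = (g₁(x̄) - y g₂(x̄)) / (g₂(x̄) - y g₃(x̄)) with (g₁(x), g₂(x), g₃(x)) = (A₀ᵀX(x)) × (A₁ᵀX(x)). Then for all x, y ∈ k such that all denominators appearing are nonzero and D(x,y) ≠ 0, D(x̄, y) ≠ 0, D(x̄, ȳ) ≠ 0, one has I(x̄, ȳ) = -I(x,y); in particular φ preserves the biquartic invariant I². -/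
open Matrix

noncomputable section

/-- If `d` is apolar to the binary quadratic form `n`, the polar involution of `n` reverses the sign
of the ratio of the two forms. -/
theorem polar_involution_ratio {k : Type*} [Field k] {n₀ n₁ n₂ d₀ d₁ d₂ x x' : k}
    (hapolar : 2 * (d₀ * n₂ + d₂ * n₀) = d₁ * n₁) (hden : 2 * n₀ * x + n₁ ≠ 0)
    (hx' : x' = -((n₁ * x + 2 * n₂) / (2 * n₀ * x + n₁)))
    (hd : d₀ * x ^ 2 + d₁ * x + d₂ ≠ 0) (hd' : d₀ * x' ^ 2 + d₁ * x' + d₂ ≠ 0) :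
    (n₀ * x' ^ 2 + n₁ * x' + n₂) / (d₀ * x' ^ 2 + d₁ * x' + d₂) =
      -((n₀ * x ^ 2 + n₁ * x + n₂) / (d₀ * x ^ 2 + d₁ * x + d₂)) := by
  have hmul : x' * (2 * n₀ * x + n₁) = -(n₁ * x + 2 * n₂) := by
    rw [hx', neg_mul, div_mul_cancel₀ _ hden]
  have hn : (n₀ * x' ^ 2 + n₁ * x' + n₂) * (2 * n₀ * x + n₁) ^ 2 =
      -((n₁ ^ 2 - 4 * n₀ * n₂) * (n₀ * x ^ 2 + n₁ * x + n₂)) := by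
    linear_combination (n₀ * (x' * (2 * n₀ * x + n₁) - (n₁ * x + 2 * n₂)) +
      n₁ * (2 * n₀ * x + n₁)) * hmul
  have hd₂ : (d₀ * x' ^ 2 + d₁ * x' + d₂) * (2 * n₀ * x + n₁) ^ 2 =
      (n₁ ^ 2 - 4 * n₀ * n₂) * (d₀ * x ^ 2 + d₁ * x + d₂) := by
    linear_combination (d₀ * (x' * (2 * n₀ * x + n₁) - (n₁ * x + 2 * n₂)) +
      d₁ * (2 * n₀ * x + n₁)) * hmul +
      (2 * n₀ * x ^ 2 + 2 * n₁ * x + 2 * n₂) * hapolar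
  rw [← neg_div, div_eq_div_iff hd' hd]
  refine mul_right_cancel₀ (pow_ne_zero 2 hden) ?_
  linear_combination (d₀ * x ^ 2 + d₁ * x + d₂) * hn + (n₀ * x ^ 2 + n₁ * x + n₂) * hd₂

/-- The involution attached to the cross product of two quadratics preserves their ratio. -/
theorem cross_involution_ratio {k : Type*} [Field k] {p q : Fin 3 → k} {y y' : k}
    (hden : (p ⨯₃ q) 1 - y * (p ⨯₃ q) 2 ≠ 0)
    (hy' : y' = ((p ⨯₃ q) 0 - y * (p ⨯₃ q) 1) / ((p ⨯₃ q) 1 - y * (p ⨯₃ q) 2))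
    (hq : q ⬝ᵥ Xv y ≠ 0) (hq' : q ⬝ᵥ Xv y' ≠ 0) :
    (p ⬝ᵥ Xv y') / (q ⬝ᵥ Xv y') = (p ⬝ᵥ Xv y) / (q ⬝ᵥ Xv y) := by
  rw [eq_div_iff hden] at hy'
  rw [div_eq_div_iff hq' hq]
  simp only [cross_apply, Xv, dotProduct, Fin.sum_univ_three, cons_val] at hy' ⊢
  linear_combination (y - y') * hy'

theorem stmt11 {k : Type*} [Field k] (hchar : (2 : k) ≠ 0)
    (α β γ δ ε ζ κ lam μ b c f m : k)
(α₁ β₁ γ₁ δ₁ ε₁ ζ₁ κ₁ lam₁ μ₁ : k)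
    (hα₁ : α₁ = 2 * α ^ 2 * f - c * α * δ + b * β * δ - b * α * ε)
    (hβ₁ : β₁ = 2 * f * α * β + b * γ * δ - c * α * ε - b * α * ζ)
    (hγ₁ : γ₁ = 2 * f * α * γ - c * α * ζ)
    (hδ₁ : δ₁ = 2 * m * α ^ 2 - 2 * c * α * κ + 2 * b * β * κ - 2 * b * α * lam)
    (hε₁ : ε₁ = 2 * m * α * β + 2 * b * γ * κ - 2 * c * α * lam - 2 * b * α * μ)
    (hζ₁ : ζ₁ = 2 * m * α * γ - 2 * c * α * μ)
    (hκ₁ : κ₁ = m * α * δ - 2 * f * α * κ + b * ε * κ - b * δ * lam)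
    (hlam₁ : lam₁ = m * α * ε + b * ζ * κ - 2 * f * α * lam - b * δ * μ)
    (hμ₁ : μ₁ = m * α * ζ - 2 * f * α * μ)
    (A₀ A₁ : Matrix (Fin 3) (Fin 3) k)
    (hA₀ : A₀ = !![α, β, γ; δ, ε, ζ; κ, lam, μ])
    (hA₁ : A₁ = !![α₁, β₁, γ₁; δ₁, ε₁, ζ₁; κ₁, lam₁, μ₁])
    (x y x' y' : k)
    (hden : 2 * (α * y ^ 2 + β * y + γ) * x + (δ * y ^ 2 + ε * y + ζ) ≠ 0)
    (hx' : x' = -(((δ * y ^ 2 + ε * y + ζ) * x + 2 * (κ * y ^ 2 + lam * y + μ)) /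
      (2 * (α * y ^ 2 + β * y + γ) * x + (δ * y ^ 2 + ε * y + ζ))))
    (g : Fin 3 → k) (hg : g = crossProduct (A₀ᵀ.mulVec (Xv x')) (A₁ᵀ.mulVec (Xv x')))
    (hdeng : g 1 - y * g 2 ≠ 0)
    (hy' : y' = (g 0 - y * g 1) / (g 1 - y * g 2))
    (hD : Nf A₁ x y ≠ 0) (hD' : Nf A₁ x' y ≠ 0) (hD'' : Nf A₁ x' y' ≠ 0) :
    Iinv A₀ A₁ x' y' = -Iinv A₀ A₁ x y ∧
    (Iinv A₀ A₁ x' y') ^ 2 = (Iinv A₀ A₁ x y) ^ 2 := by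
  have hNf (A : Matrix (Fin 3) (Fin 3) k) (s t : k) : Nf A s t = (Aᵀ *ᵥ Xv s) ⬝ᵥ Xv t := by
    rw [Nf, dotProduct_mulVec, mulVec_transpose]
  have hcol (A : Matrix (Fin 3) (Fin 3) k) (s t : k) :
      Nf A s t = (A *ᵥ Xv t) 0 * s ^ 2 + (A *ᵥ Xv t) 1 * s + (A *ᵥ Xv t) 2 := by
    simp only [Nf, Xv, dotProduct, Fin.sum_univ_three, cons_val]
    ring
  have hvertical : Iinv A₀ A₁ x' y' = Iinv A₀ A₁ x' y := by
    subst hg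
    simp only [Iinv, hNf] at hD' hD'' ⊢
    exact cross_involution_ratio hdeng hy' hD' hD''
  have hhorizontal : Iinv A₀ A₁ x' y = -Iinv A₀ A₁ x y := by
    have h₀ : (A₀ *ᵥ Xv y) 0 = α * y ^ 2 + β * y + γ := by
      simp [hA₀, Xv, mulVec, dotProduct, Fin.sum_univ_three]
    have h₁ : (A₀ *ᵥ Xv y) 1 = δ * y ^ 2 + ε * y + ζ := by
      simp [hA₀, Xv, mulVec, dotProduct, Fin.sum_univ_three]
    have h₂ : (A₀ *ᵥ Xv y) 2 = κ * y ^ 2 + lam * y + μ := by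
      simp [hA₀, Xv, mulVec, dotProduct, Fin.sum_univ_three]
    simp only [Iinv, hcol] at hD hD' ⊢
    rw [← h₀, ← h₁] at hden
    rw [← h₀, ← h₁, ← h₂] at hx'
    refine polar_involution_ratio ?_ hden hx' hD hD'
    rw [h₀, h₁, h₂]
    simp only [hA₁, Xv, mulVec, dotProduct, Fin.sum_univ_three, of_apply, cons_val]
    subst_vars
    ring
  have h := hvertical.trans hhorizontal
  exact ⟨h, by rw [h, neg_sq]⟩
end
end

section
/- Let k be a field of characteristic ≠ 2 and let α, β, γ, δ, ε, μ ∈ k. Set A₀ = [[α,β,γ],[β,ε,δ],[γ,δ,μ]] and A₁ = [[α₁,β₁,γ₁],[β₁,ε₁,δ₁],[γ₁,δ₁,μ₁]] where α₁ = αε - β², β₁ = 2αδ - 2βγ, γ₁ = βδ - γε, ε₁ = 4αμ - 4γ², δ₁ = 2βμ - 2γδ, μ₁ = εμ - δ². Define the dual symmetric non-QRT map φ(x,y) = (y, ȳ) with ȳ = -(2γ₁y² + 2δ₁y + 2μ₁ + x(β₁y² + ε₁y + δ₁)) / (β₁y² + ε₁y + δ₁ + 2x(α₁y² + β₁y + γ₁)).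 Then for all x, y ∈ k such that the denominator of ȳ is nonzero, D(x,y) ≠ 0 and D(y, ȳ) ≠ 0, one has I(y, ȳ) = -I(x,y); in particular φ preserves the biquartic invariant I². -/
open Matrix

noncomputable section

/-- The involution of the line fixing the roots of `p t² + q t + r` negates that quadratic, up to
the discriminant and the square of the denominator. -/
theorem quadratic_involution_neg {k : Type*} [Field k] (p q r x y' : k)
    (h : y' * (q + 2 * x * p) = -(2 * r + x * q)) :
    (p * y' ^ 2 + q * y' + r) * (q + 2 * x * p) ^ 2 =
      -((q ^ 2 - 4 * p * r) * (p * x ^ 2 + q * x + r)) := by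
  linear_combination (p * (y' * (q + 2 * x * p) - (2 * r + x * q)) + q * (q + 2 * x * p)) * h

/-- The involution of the line fixing the roots of `p t² + q t + r` preserves every quadratic
apolar to it, up to the discriminant and the square of the denominator. -/
theorem quadratic_involution_of_apolar {k : Type*} [Field k] (a b c p q r x y' : k)
    (hap : 2 * a * r - b * q + 2 * c * p = 0)
    (h : y' * (q + 2 * x * p) = -(2 * r + x * q)) :
    (a * y' ^ 2 + b * y' + c) * (q + 2 * x * p) ^ 2 =
      (q ^ 2 - 4 * p * r) * (a * x ^ 2 + b * x + c) := by
  linear_combination (a * (y' * (q + 2 * x * p) - (2 * r + x * q)) + b * (q + 2 * x * p)) * h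
    + (2 * p * x ^ 2 + 2 * q * x + 2 * r) * hap

/-- A symmetric biquadratic form, expanded as a quadratic in its first variable. -/
theorem Nf_symm_left {k : Type*} [Field k] (a b c d e m x y : k) :
    Nf !![a, b, c; b, e, d; c, d, m] x y =
      (a * y ^ 2 + b * y + c) * x ^ 2 + (b * y ^ 2 + e * y + d) * x
        + (c * y ^ 2 + d * y + m) := by
  simp [Nf, Xv, dotProduct, mulVec, Fin.sum_univ_three]
  ring

/-- A symmetric biquadratic form, expanded as a quadratic in its second variable. -/
theorem Nf_symm_right {k : Type*} [Field k] (a b c d e m x y : k) :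
    Nf !![a, b, c; b, e, d; c, d, m] x y =
      (a * x ^ 2 + b * x + c) * y ^ 2 + (b * x ^ 2 + e * x + d) * y
        + (c * x ^ 2 + d * x + m) := by
  rw [Nf_symm_left]
  ring

theorem stmt14 {k : Type*} [Field k] (hchar : (2 : k) ≠ 0)
    (α β γ δ ε μ : k)
(α₁ β₁ γ₁ ε₁ δ₁ μ₁ : k)
    (hα₁ : α₁ = α * ε - β ^ 2)
    (hβ₁ : β₁ = 2 * α * δ - 2 * β * γ)
    (hγ₁ : γ₁ = β * δ - γ * ε)
    (hε₁ : ε₁ = 4 * α * μ - 4 * γ ^ 2)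
    (hδ₁ : δ₁ = 2 * β * μ - 2 * γ * δ)
    (hμ₁ : μ₁ = ε * μ - δ ^ 2)
    (A₀ A₁ : Matrix (Fin 3) (Fin 3) k)
    (hA₀ : A₀ = !![α, β, γ; β, ε, δ; γ, δ, μ])
    (hA₁ : A₁ = !![α₁, β₁, γ₁; β₁, ε₁, δ₁; γ₁, δ₁, μ₁])
    (x y y' : k)
    (hden : β₁ * y ^ 2 + ε₁ * y + δ₁ + 2 * x * (α₁ * y ^ 2 + β₁ * y + γ₁) ≠ 0)
    (hy' : y' = -((2 * γ₁ * y ^ 2 + 2 * δ₁ * y + 2 * μ₁ + x * (β₁ * y ^ 2 + ε₁ * y + δ₁)) /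
      (β₁ * y ^ 2 + ε₁ * y + δ₁ + 2 * x * (α₁ * y ^ 2 + β₁ * y + γ₁))))
    (hD : Nf A₁ x y ≠ 0) (hD' : Nf A₁ y y' ≠ 0) :
    Iinv A₀ A₁ y y' = -Iinv A₀ A₁ x y ∧
    (Iinv A₀ A₁ y y') ^ 2 = (Iinv A₀ A₁ x y) ^ 2 := by
  have key : Iinv A₀ A₁ y y' = -Iinv A₀ A₁ x y := by
    have hlin : y' * (β₁ * y ^ 2 + ε₁ * y + δ₁ + 2 * x * (α₁ * y ^ 2 + β₁ * y + γ₁)) =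
        -(2 * (γ₁ * y ^ 2 + δ₁ * y + μ₁) + x * (β₁ * y ^ 2 + ε₁ * y + δ₁)) := by
      rw [hy', neg_mul, div_mul_cancel₀ _ hden]
      ring
    have hap : 2 * (α * y ^ 2 + β * y + γ) * (γ₁ * y ^ 2 + δ₁ * y + μ₁)
        - (β * y ^ 2 + ε * y + δ) * (β₁ * y ^ 2 + ε₁ * y + δ₁)
        + 2 * (γ * y ^ 2 + δ * y + μ) * (α₁ * y ^ 2 + β₁ * y + γ₁) = 0 := by
      rw [hα₁, hβ₁, hγ₁, hε₁, hδ₁, hμ₁]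
      ring
    have hNeq := quadratic_involution_of_apolar _ _ _ _ _ _ x y' hap hlin
    have hDeq := quadratic_involution_neg _ _ _ x y' hlin
    rw [Iinv, Iinv, ← neg_div, div_eq_div_iff hD' hD]
    rw [hA₀, hA₁, Nf_symm_right _ _ _ _ _ _ y y', Nf_symm_right _ _ _ _ _ _ y y',
      Nf_symm_left _ _ _ _ _ _ x y, Nf_symm_left _ _ _ _ _ _ x y]
    refine mul_right_cancel₀ (pow_ne_zero 2 hden) ?_
    rw [mul_right_comm, hNeq, mul_assoc _ _ (_ ^ 2), hDeq]
    ring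
  exact ⟨key, by rw [key, neg_sq]⟩
end
end

section
/- Let k be a field of characteristic ≠ 2, let γ, μ ∈ k, and define I(u,v) = (u²v² + γ(u² + v²) + μ)/(uv) for u, v ∈ k with uv ≠ 0. Suppose y₋, y, y₊ ∈ k are all nonzero, y² + γ ≠ 0, and y₊ y₋ = -(μ + γy²)/(y² + γ). Then I(y, y₊) = -I(y₋, y). In particular the three-point map ȳ·y̲ = -(μ + γy²)/(y² + γ) preserves the biquartic quantity I(y̲, y)². -/
theorem stmt15 {k : Type*} [Field k] (hchar : (2 : k) ≠ 0) (γ μ : k)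
    (I : k → k → k)
    (hI : ∀ u v : k, I u v = (u ^ 2 * v ^ 2 + γ * (u ^ 2 + v ^ 2) + μ) / (u * v))
    (ym y yp : k) (hym : ym ≠ 0) (hy : y ≠ 0) (hyp : yp ≠ 0)
    (hnz : y ^ 2 + γ ≠ 0)
    (hmap : yp * ym = -((μ + γ * y ^ 2) / (y ^ 2 + γ))) :
    I y yp = -I ym y ∧ (I y yp) ^ 2 = (I ym y) ^ 2 := by
  have hB : μ + γ * y ^ 2 = -((y ^ 2 + γ) * (yp * ym)) := by
    rw [hmap]
    field_simp
  have hforward : I y yp = (y ^ 2 + γ) * (yp - ym) / y := by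
    rw [hI, div_eq_div_iff (mul_ne_zero hy hyp) hy]
    linear_combination y * hB
  have hbackward : I ym y = (y ^ 2 + γ) * (ym - yp) / y := by
    rw [hI, div_eq_div_iff (mul_ne_zero hym hy) hy]
    linear_combination y * hB
  have hneg : I y yp = -I ym y := by
    rw [hforward, hbackward]
    ring
  exact ⟨hneg, by rw [hneg, neg_sq]⟩
end

section
/- Let k be a field of characteristic ≠ 2, let γ, μ, λ ∈ k, let s ∈ {1, -1}, and let a, b, c ∈ k be nonzero with b² + γ ≠ 0 and satisfying c·a·(b² + γ) = -(μ + γb²) (i.e. a, b, c are consecutive iterates y_{n-1}, y_n, y_{n+1} of the map y_{n+1}y_{n-1} = -(μ+γy_n²)/(y_n²+γ), with s = (-1)ⁿ). Define the 2×2 matrices L(u,v,σ) = [[σuv, -γ],[λ - u² - v², σ(μ + γ(u² + v²))/(uv)]] and M(u,v,σ) = [[0, -γ],[λ - u² - v², σγ(μ + γv² + u²(γ + v²))/(uv(γ + v²))]]. Then the discrete Lax compatibility condition holds: L(b, c, -s)·M(a, b, s) = M(a, b, s)·L(a, b, s). -/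
/-- The Lax matrix `Lₙ(λ)` of the non-QRT map `y_{n+1} y_{n-1} = -(μ + γ yₙ²)/(yₙ² + γ)`,
with `u = y_{n-1}`, `v = yₙ` and sign `σ = (-1)ⁿ`. -/
noncomputable def Lax_L {k : Type*} [Field k] (γ μ lam : k) (u v σ : k) :
    Matrix (Fin 2) (Fin 2) k :=
  !![σ * u * v, -γ;
     lam - u ^ 2 - v ^ 2, σ * (μ + γ * (u ^ 2 + v ^ 2)) / (u * v)]

/-- The Lax matrix `Mₙ(λ)` of the non-QRT map `y_{n+1} y_{n-1} = -(μ + γ yₙ²)/(yₙ² + γ)`,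
with `u = y_{n-1}`, `v = yₙ` and sign `σ = (-1)ⁿ`. -/
noncomputable def Lax_M {k : Type*} [Field k] (γ μ lam : k) (u v σ : k) :
    Matrix (Fin 2) (Fin 2) k :=
  !![0, -γ;
     lam - u ^ 2 - v ^ 2, σ * γ * (μ + γ * v ^ 2 + u ^ 2 * (γ + v ^ 2)) / (u * v * (γ + v ^ 2))]

section

variable {k : Type*} [Field k] {γ μ s a b c : k}

/-- On an orbit of the map, the lower right entry of `Lₙ` is a Laurent polynomial. -/
theorem Lax_L_entry_eq (ha : a ≠ 0) (hb : b ≠ 0)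
    (hmap : c * a * (b ^ 2 + γ) = -(μ + γ * b ^ 2)) :
    s * (μ + γ * (a ^ 2 + b ^ 2)) / (a * b) = s * (γ * a - c * (b ^ 2 + γ)) / b := by
  have hμ : μ = -(c * a * (b ^ 2 + γ)) - γ * b ^ 2 := by linear_combination hmap
  subst hμ
  field_simp
  ring

/-- On an orbit of the map, the lower right entry of `Lₙ₊₁` is a Laurent polynomial. -/
theorem Lax_L_succ_entry_eq (hb : b ≠ 0) (hc : c ≠ 0)
    (hmap : c * a * (b ^ 2 + γ) = -(μ + γ * b ^ 2)) :
    -s * (μ + γ * (b ^ 2 + c ^ 2)) / (b * c) = s * (a * (b ^ 2 + γ) - γ * c) / b := by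
  have hμ : μ = -(c * a * (b ^ 2 + γ)) - γ * b ^ 2 := by linear_combination hmap
  subst hμ
  field_simp
  ring

/-- On an orbit of the map, the lower right entry of `Mₙ` is a Laurent polynomial. -/
theorem Lax_M_entry_eq (ha : a ≠ 0) (hb : b ≠ 0) (hnz : b ^ 2 + γ ≠ 0)
    (hmap : c * a * (b ^ 2 + γ) = -(μ + γ * b ^ 2)) :
    s * γ * (μ + γ * b ^ 2 + a ^ 2 * (γ + b ^ 2)) / (a * b * (γ + b ^ 2)) =
      s * γ * (a - c) / b := by
  have hD : γ + b ^ 2 ≠ 0 := by rwa [add_comm]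
  rw [div_eq_div_iff (mul_ne_zero (mul_ne_zero ha hb) hD) hb]
  linear_combination (s * γ * b) * hmap

end

theorem stmt16 {k : Type*} [Field k] (hchar : (2 : k) ≠ 0) (γ μ lam : k)
    (s : k) (hs : s = 1 ∨ s = -1)
    (a b c : k) (ha : a ≠ 0) (hb : b ≠ 0) (hc : c ≠ 0)
    (hnz : b ^ 2 + γ ≠ 0)
    (hmap : c * a * (b ^ 2 + γ) = -(μ + γ * b ^ 2)) :
    Lax_L γ μ lam b c (-s) * Lax_M γ μ lam a b s =
      Lax_M γ μ lam a b s * Lax_L γ μ lam a b s := by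
  have hs2 : s ^ 2 = 1 := by rcases hs with rfl | rfl <;> ring
  unfold Lax_L Lax_M
  rw [Lax_L_entry_eq ha hb hmap, Lax_L_succ_entry_eq hb hc hmap, Lax_M_entry_eq ha hb hnz hmap,
    Matrix.mul_fin_two, Matrix.mul_fin_two]
  ext i j
  fin_cases i <;> fin_cases j <;> dsimp
  · ring
  · field_simp
    ring
  · field_simp
    ring
  · field_simp
    linear_combination γ * (a ^ 2 - c ^ 2) * b ^ 2 * hs2
end
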